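/- Let k be a commutative ring, G a group, and H ≤ G a subgroup. If M is a kG-module lying in the right Ext^1-orthogonal GProj(kG)^⊥ of the class of Gorenstein projective kG-modules, then res_H^G M lies in GProj(kH)^⊥. Dually, if M lies in the left orthogonal ^⊥GInj(kG) of the Gorenstein injective kG-modules, then res_H^G M lies in ^⊥GInj(kH). -/

import Mathlib

open CategoryTheory Limits

noncomputable section

/-- The `n`-th Ext group of two `A`-modules, as a `ℤ`-module. -/
abbrev extZ (A : Type) [Ring A] (n : ℕ) (X Y : ModuleCat A) : ModuleCat ℤ :=
  ((Ext ℤ (ModuleCat A) n).obj (Opposite.op X)).obj Y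

/-- An `R`-module is Gorenstein projective if it is a cokernel of a totally acyclic complex
of projective modules: an acyclic `ℤ`-indexed complex of projectives which stays acyclic
after applying `Hom_R(−, Q)` for every projective `Q`. -/
def GorensteinProjective (R : Type) [Ring R] (M : ModuleCat R) : Prop :=
  ∃ (P : ℤ → ModuleCat R) (d : ∀ i : ℤ, P i ⟶ P (i+1)),
    (∀ i, Projective (P i)) ∧
    (∀ i, Function.Exact (d i) (d (i+1))) ∧
    (∀ (Q : ModuleCat R), Projective Q → ∀ i,
      Function.Exact (fun g : P (i+1+1) ⟶ Q => d (i+1) ≫ g)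
        (fun g : P (i+1) ⟶ Q => d i ≫ g)) ∧
    Nonempty (M ≅ cokernel (d 0))

/-- An `R`-module is Gorenstein injective if it is a kernel of a totally acyclic complex
of injective modules: an acyclic `ℤ`-indexed complex of injectives which stays acyclic
after applying `Hom_R(J, −)` for every injective `J`. -/
def GorensteinInjective (R : Type) [Ring R] (M : ModuleCat R) : Prop :=
  ∃ (I : ℤ → ModuleCat R) (d : ∀ i : ℤ, I i ⟶ I (i+1)),
    (∀ i, Injective (I i)) ∧
    (∀ i, Function.Exact (d i) (d (i+1))) ∧
    (∀ (J : ModuleCat R), Injective J → ∀ i,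
      Function.Exact (fun g : J ⟶ I i => g ≫ d i)
        (fun g : J ⟶ I (i+1) => g ≫ d (i+1))) ∧
    Nonempty (M ≅ kernel (d 0))

/-- The right `Ext¹`-orthogonal class `GProj(R)^⊥` of the Gorenstein projective modules. -/
def gprojPerp (R : Type) [Ring R] : Set (ModuleCat R) :=
  {N | ∀ L, GorensteinProjective R L → Subsingleton (extZ R 1 L N)}

/-- The left `Ext¹`-orthogonal class `^⊥GInj(R)` of the Gorenstein injective modules. -/
def ginjPerp (R : Type) [Ring R] : Set (ModuleCat R) :=
  {M | ∀ N, GorensteinInjective R N → Subsingleton (extZ R 1 M N)}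

/-- The inclusion of group algebras `kH → kG` induced by the inclusion of a subgroup. -/
def grpAlgInc (k : Type) [CommRing k] (G : Type) [Group G] (H : Subgroup G) :
    MonoidAlgebra k H →+* MonoidAlgebra k G :=
  MonoidAlgebra.mapDomainRingHom k H.subtype

/-- Eckmann–Shapiro at the level of complexes. -/
lemma ext_subsingleton_of_adj {R S : Type} [Ring R] [Ring S]
    {F : ModuleCat.{0} R ⥤ ModuleCat.{0} S} {U : ModuleCat.{0} S ⥤ ModuleCat.{0} R} (adj : F ⊣ U)
    [F.Additive] [F.PreservesHomology] [F.PreservesProjectiveObjects]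
    (n : ℕ) (X : ModuleCat R) (Y : ModuleCat S)
    (h : Subsingleton (extZ S n (F.obj X) Y)) : Subsingleton (extZ R n X (U.obj Y)) := by
  let P := projectiveResolution X
  have e1 := P.isoExt (R := ℤ) n (U.obj Y)
  have e2 := (F.mapProjectiveResolution P).isoExt (R := ℤ) n Y
  have e3 : (F.mapProjectiveResolution P).complex.linearYonedaObj ℤ Y ≅
      P.complex.linearYonedaObj ℤ (U.obj Y) :=
    HomologicalComplex.Hom.isoOfComponents
      (fun i ↦ (adj.homAddEquiv (P.complex.X i) Y).toIntLinearEquiv.toModuleIso) fun i j _ ↦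
        ModuleCat.hom_ext (LinearMap.ext fun f => (adj.homEquiv_naturality_left (P.complex.d j i) f).symm)
  have e := e2 ≪≫ (HomologicalComplex.homologyFunctor _ _ n).mapIso e3 ≪≫ e1.symm
  exact e.toLinearEquiv.toEquiv.symm.subsingleton

/-- Eckmann–Shapiro at the level of complexes. -/
lemma ext_subsingleton_of_adj' {R S : Type} [Ring R] [Ring S]
    {F : ModuleCat.{0} R ⥤ ModuleCat.{0} S} {U : ModuleCat.{0} S ⥤ ModuleCat.{0} R} (adj : F ⊣ U)
    [F.Additive] [F.PreservesHomology] [F.PreservesProjectiveObjects]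
    (n : ℕ) (X : ModuleCat R) (Y : ModuleCat S)
    (h : Subsingleton (extZ R n X (U.obj Y))) : Subsingleton (extZ S n (F.obj X) Y) := by
  let P := projectiveResolution X
  have e1 := P.isoExt (R := ℤ) n (U.obj Y)
  have e2 := (F.mapProjectiveResolution P).isoExt (R := ℤ) n Y
  have e3 : (F.mapProjectiveResolution P).complex.linearYonedaObj ℤ Y ≅
      P.complex.linearYonedaObj ℤ (U.obj Y) :=
    HomologicalComplex.Hom.isoOfComponents
      (fun i ↦ (adj.homAddEquiv (P.complex.X i) Y).toIntLinearEquiv.toModuleIso) fun i j _ ↦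
        ModuleCat.hom_ext (LinearMap.ext fun f => (adj.homEquiv_naturality_left (P.complex.d j i) f).symm)
  have e := e2 ≪≫ (HomologicalComplex.homologyFunctor _ _ n).mapIso e3 ≪≫ e1.symm
  exact e.toLinearEquiv.toEquiv.subsingleton

lemma map_function_exact {R S : Type} [Ring R] [Ring S]
    (F : ModuleCat.{0} R ⥤ ModuleCat.{0} S) [F.Additive] [F.PreservesHomology]
    {X Y Z : ModuleCat R} (f : X ⟶ Y) (g : Y ⟶ Z) (h : Function.Exact f g) :
    Function.Exact (F.map f) (F.map g) := by
  have w : f ≫ g = 0 := by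
    ext x
    exact h.apply_apply_eq_zero x
  have h1 : (ShortComplex.mk f g w).Exact :=
    (ShortComplex.ShortExact.moduleCat_exact_iff_function_exact _).2 h
  exact (ShortComplex.ShortExact.moduleCat_exact_iff_function_exact _).1 (h1.map F)

lemma gproj_map {R S : Type} [Ring R] [Ring S]
    {F : ModuleCat.{0} R ⥤ ModuleCat.{0} S} {U : ModuleCat.{0} S ⥤ ModuleCat.{0} R} (adj : F ⊣ U)
    [F.Additive] [F.PreservesHomology] [F.PreservesProjectiveObjects]
    [U.PreservesProjectiveObjects] (L : ModuleCat R) (h : GorensteinProjective R L) :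
    GorensteinProjective S (F.obj L) := by
  obtain ⟨P, d, hP, hd, hQ, ⟨e⟩⟩ := h
  refine ⟨fun i => F.obj (P i), fun i => F.map (d i), fun i => F.projective_obj_of_projective (hP i),
    fun i => map_function_exact F _ _ (hd i), fun Q hQ' i g => ?_, ?_⟩
  · have := hQ (U.obj Q) (U.projective_obj_of_projective hQ') i (adj.homAddEquiv _ _ g)
    have e1 : F.map (d i) ≫ g = 0 ↔ d i ≫ adj.homAddEquiv _ _ g = 0 := by
      rw [Adjunction.homAddEquiv_apply, ← adj.homEquiv_naturality_left, ← adj.homAddEquiv_apply]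
      exact (EmbeddingLike.map_eq_zero_iff (f := adj.homAddEquiv _ _)).symm
    refine e1.trans (this.trans ⟨?_, ?_⟩)
    · rintro ⟨f, hf⟩
      refine ⟨(adj.homEquiv _ _).symm f, ?_⟩
      dsimp only at hf ⊢
      rw [← adj.homEquiv_naturality_left_symm, hf]
      exact (adj.homEquiv _ _).symm_apply_apply g
    · rintro ⟨f, hf⟩
      refine ⟨adj.homEquiv _ _ f, ?_⟩
      dsimp only at hf ⊢
      rw [← adj.homEquiv_naturality_left, hf]
      rfl
  · have := Functor.PreservesHomology.preservesCokernel F (d 0)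
    exact ⟨F.mapIso e ≪≫ PreservesCokernel.iso F (d 0)⟩

lemma ginj_map {R S : Type} [Ring R] [Ring S]
    {F : ModuleCat.{0} R ⥤ ModuleCat.{0} S} {U : ModuleCat.{0} S ⥤ ModuleCat.{0} R} (adj : F ⊣ U)
    [F.Additive] [U.Additive] [U.PreservesHomology] [U.PreservesInjectiveObjects]
    [F.PreservesInjectiveObjects] (L : ModuleCat S) (h : GorensteinInjective S L) :
    GorensteinInjective R (U.obj L) := by
  obtain ⟨P, d, hP, hd, hQ, ⟨e⟩⟩ := h
  refine ⟨fun i => U.obj (P i), fun i => U.map (d i), fun i => U.injective_obj_of_injective (hP i),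
    fun i => map_function_exact U _ _ (hd i), fun Q hQ' i g => ?_, ?_⟩
  · have := hQ (F.obj Q) (F.injective_obj_of_injective hQ') i ((adj.homAddEquiv _ _).symm g)
    have e1 : g ≫ U.map (d (i+1)) = 0 ↔ (adj.homAddEquiv _ _).symm g ≫ d (i+1) = 0 := by
      rw [Adjunction.homAddEquiv_symm_apply, ← adj.homEquiv_naturality_right_symm,
        ← adj.homAddEquiv_symm_apply]
      exact (EmbeddingLike.map_eq_zero_iff (f := (adj.homAddEquiv _ _).symm)).symm
    refine e1.trans (this.trans ⟨?_, ?_⟩)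
    · rintro ⟨f, hf⟩
      refine ⟨adj.homEquiv _ _ f, ?_⟩
      dsimp only at hf ⊢
      rw [← adj.homEquiv_naturality_right, hf]
      exact (adj.homEquiv _ _).apply_symm_apply g
    · rintro ⟨f, hf⟩
      refine ⟨(adj.homEquiv _ _).symm f, ?_⟩
      dsimp only at hf ⊢
      rw [← adj.homEquiv_naturality_right_symm, hf]
      rfl
  · have := Functor.PreservesHomology.preservesKernel U (d 0)
    exact ⟨U.mapIso e ≪≫ PreservesKernel.iso U (d 0)⟩

lemma res_isRightAdjoint {R S : Type} [Ring R] [Ring S] (f : R →+* S) :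
    (ModuleCat.restrictScalars.{0} f).IsRightAdjoint := by
  have : PreservesLimits (ModuleCat.restrictScalars.{0} f ⋙ forget (ModuleCat R)) :=
    inferInstanceAs (PreservesLimits (forget (ModuleCat S)))
  have : PreservesLimits (ModuleCat.restrictScalars.{0} f) :=
    preservesLimits_of_reflects_of_preserves _ (forget (ModuleCat R))
  exact
  isRightAdjoint_of_preservesLimits_of_isCoseparating (isCoseparator_coseparator _) _

lemma main_of_exact {R S : Type} [Ring R] [Ring S] (f : R →+* S)
    {F : ModuleCat.{0} R ⥤ ModuleCat.{0} S} (adj : F ⊣ ModuleCat.restrictScalars.{0} f)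
    (hm : F.PreservesMonomorphisms) (he : (ModuleCat.coextendScalars.{0,0,0} f).PreservesEpimorphisms)
    (M : ModuleCat S) :
    (M ∈ gprojPerp S → (ModuleCat.restrictScalars f).obj M ∈ gprojPerp R) ∧
    (M ∈ ginjPerp S → (ModuleCat.restrictScalars f).obj M ∈ ginjPerp R) := by
  have adj' : ModuleCat.restrictScalars.{0} f ⊣ ModuleCat.coextendScalars.{0,0,0} f :=
    ModuleCat.restrictCoextendScalarsAdj f
  have := adj.left_adjoint_additive
  have := adj'.right_adjoint_additive
  have : PreservesColimits F := adj.leftAdjoint_preservesColimits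
  have : PreservesColimits (ModuleCat.restrictScalars.{0} f) := adj'.leftAdjoint_preservesColimits
  have : PreservesLimits (ModuleCat.coextendScalars.{0,0,0} f) :=
    adj'.rightAdjoint_preservesLimits
  have : F.PreservesHomology := Functor.preservesHomology_of_preservesMonos_and_cokernels F
  have : (ModuleCat.coextendScalars.{0,0,0} f).PreservesHomology :=
    Functor.preservesHomology_of_preservesEpis_and_kernels _
  have : (ModuleCat.restrictScalars.{0} f).PreservesHomology :=
    Functor.preservesHomology_of_preservesMonos_and_cokernels _
  have : (ModuleCat.restrictScalars.{0} f).PreservesEpimorphisms := inferInstance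
  have := Functor.preservesProjectiveObjects_of_adjunction_of_preservesEpimorphisms adj
  have := Functor.preservesProjectiveObjects_of_adjunction_of_preservesEpimorphisms adj'
  have := Functor.preservesInjectiveObjects_of_adjunction_of_preservesMonomorphisms adj
  have := Functor.preservesInjectiveObjects_of_adjunction_of_preservesMonomorphisms adj'
  refine ⟨fun h L hL => ?_, fun h N hN => ?_⟩
  · exact ext_subsingleton_of_adj adj 1 L M (h _ (gproj_map adj L hL))
  · exact ext_subsingleton_of_adj' adj' 1 M N (h _ (ginj_map adj' N hN))

section concrete

variable (k : Type) [CommRing k] (G : Type) [Group G] (H : Subgroup G)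

lemma grpAlgInc_single (h : H) (t : k) :
    grpAlgInc k G H (MonoidAlgebra.single h t) = MonoidAlgebra.single (h : G) t := by
  simp [grpAlgInc]

/-- The projection `kG → kH`. -/
def pr : MonoidAlgebra k G →+ MonoidAlgebra k H where
  toFun x := MonoidAlgebra.ofCoeff (x.coeff.comapDomain Subtype.val Subtype.val_injective.injOn)
  map_zero' := by ext; simp
  map_add' x y := by ext; simp

lemma pr_single_mem (g : G) (hg : g ∈ H) (t : k) :
    pr k G H (MonoidAlgebra.single g t) = MonoidAlgebra.single ⟨g, hg⟩ t := by
  classical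
  ext x
  simp [pr, Finsupp.single_apply, Subtype.ext_iff]

lemma pr_single_not_mem (g : G) (hg : g ∉ H) (t : k) :
    pr k G H (MonoidAlgebra.single g t) = 0 := by
  classical
  ext x
  simp [pr, Finsupp.single_apply]
  rintro rfl
  exact absurd x.2 hg

lemma pr_mul_left (x : MonoidAlgebra k H) (y : MonoidAlgebra k G) :
    pr k G H (grpAlgInc k G H x * y) = x * pr k G H y := by
  induction x using MonoidAlgebra.induction_linear with
  | zero => simp
  | add a b ha hb => simp only [map_add, add_mul, ha, hb]
  | single h t =>
    induction y using MonoidAlgebra.induction_linear with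
    | zero => simp
    | add a b ha hb => simp only [map_add, mul_add, ha, hb]
    | single g u =>
      rw [grpAlgInc_single, MonoidAlgebra.single_mul_single]
      by_cases hg : g ∈ H
      · rw [pr_single_mem k G H _ (H.mul_mem h.2 hg), pr_single_mem k G H _ hg,
          MonoidAlgebra.single_mul_single]
        rfl
      · rw [pr_single_not_mem k G H _ (fun h' => hg ((H.mul_mem_cancel_left h.2).1 h')),
          pr_single_not_mem k G H _ hg, mul_zero]

lemma pr_mul_right (x : MonoidAlgebra k H) (y : MonoidAlgebra k G) :
    pr k G H (y * grpAlgInc k G H x) = pr k G H y * x := by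
  induction x using MonoidAlgebra.induction_linear with
  | zero => simp
  | add a b ha hb => simp only [map_add, mul_add, ha, hb]
  | single h t =>
    induction y using MonoidAlgebra.induction_linear with
    | zero => simp
    | add a b ha hb => simp only [map_add, add_mul, ha, hb]
    | single g u =>
      rw [grpAlgInc_single, MonoidAlgebra.single_mul_single]
      by_cases hg : g ∈ H
      · rw [pr_single_mem k G H _ (H.mul_mem hg h.2), pr_single_mem k G H _ hg,
          MonoidAlgebra.single_mul_single]
        rfl
      · rw [pr_single_not_mem k G H _ (fun h' => hg ((H.mul_mem_cancel_right h.2).1 h')),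
          pr_single_not_mem k G H _ hg, zero_mul]

/-- Representative of the coset `Hg`. -/
def rr (g : G) : G := (Quotient.mk (QuotientGroup.rightRel H) g).out

lemma rr_mem (g : G) : g * (rr G H g)⁻¹ ∈ H := by
  have : Quotient.mk (QuotientGroup.rightRel H) (rr G H g) = Quotient.mk _ g := Quotient.out_eq _
  exact QuotientGroup.rightRel_apply.1 (Quotient.exact this)

lemma rr_mul (h : H) (g : G) : rr G H (h * g) = rr G H g := by
  unfold rr
  congr 1
  apply Quotient.sound
  apply QuotientGroup.rightRel_apply.2
  simp

/-- The additive section used for projectivity of `kG` over `kH`. -/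
def sec : MonoidAlgebra k G →+ (MonoidAlgebra k G →₀ MonoidAlgebra k H) :=
  (Finsupp.liftAddHom fun g =>
    (Finsupp.singleAddHom (MonoidAlgebra.single (rr G H g) (1 : k))).comp
      (MonoidAlgebra.singleAddHom (⟨g * (rr G H g)⁻¹, rr_mem G H g⟩ : H))).comp
    MonoidAlgebra.coeffAddEquiv.toAddMonoidHom

lemma sec_single (g : G) (t : k) : sec k G H (MonoidAlgebra.single g t) =
    Finsupp.single (MonoidAlgebra.single (rr G H g) (1 : k))
      (MonoidAlgebra.single (⟨g * (rr G H g)⁻¹, rr_mem G H g⟩ : H) t) := by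
  change Finsupp.liftAddHom _ (Finsupp.single g t) = _
  rw [Finsupp.liftAddHom_apply_single]
  rfl

lemma sec_mul (x : MonoidAlgebra k H) (y : MonoidAlgebra k G) :
    sec k G H (grpAlgInc k G H x * y) = x • sec k G H y := by
  induction x using MonoidAlgebra.induction_linear with
  | zero => simp
  | add a b ha hb => simp only [map_add, add_mul, add_smul, ha, hb]
  | single h t =>
    induction y using MonoidAlgebra.induction_linear with
    | zero => simp
    | add a b ha hb => simp only [map_add, mul_add, smul_add, ha, hb]
    | single g u =>
      rw [grpAlgInc_single, MonoidAlgebra.single_mul_single, sec_single, sec_single,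
        Finsupp.smul_single, smul_eq_mul, MonoidAlgebra.single_mul_single]
      congr 2
      · rw [rr_mul]
      · ext
        simp [rr_mul, mul_assoc]

lemma kG_projective : Module.Projective (MonoidAlgebra k H)
    ((ModuleCat.restrictScalars (grpAlgInc k G H)).obj
      (ModuleCat.of (MonoidAlgebra k G) (MonoidAlgebra k G))) := by
  refine ⟨⟨{ toFun := sec k G H, map_add' := (sec k G H).map_add, map_smul' := sec_mul k G H },
    fun x => ?_⟩⟩
  change Finsupp.linearCombination _ _ (sec k G H x) = x
  induction x using MonoidAlgebra.induction_linear with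
  | zero => rw [map_zero]; exact map_zero _
  | add a b ha hb => rw [map_add, map_add, ha, hb]; rfl
  | single g t =>
    rw [sec_single]
    refine (Finsupp.linearCombination_single _ _ _).trans ?_
    change grpAlgInc k G H (MonoidAlgebra.single _ _) * MonoidAlgebra.single (rr G H g) (1 : k) = _
    rw [grpAlgInc_single, MonoidAlgebra.single_mul_single]
    simp

lemma coind_epi :
    (ModuleCat.coextendScalars.{0,0,0} (grpAlgInc k G H)).PreservesEpimorphisms where
  preserves {A B} f hf := by
    rw [ModuleCat.epi_iff_surjective] at hf ⊢
    intro φ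
    have := kG_projective k G H
    obtain ⟨ψ, hψ⟩ := Module.projective_lifting_property f.hom
      (ModuleCat.CoextendScalars.equiv (grpAlgInc k G H) B φ) hf
    refine ⟨(ModuleCat.CoextendScalars.equiv (grpAlgInc k G H) A).symm ψ, ?_⟩
    apply ModuleCat.CoextendScalars.ext
    exact hψ

/-- The natural map `A → res coind A`. -/
def toCoind (A : ModuleCat.{0} (MonoidAlgebra k H)) :
    A ⟶ (ModuleCat.restrictScalars (grpAlgInc k G H)).obj
      ((ModuleCat.coextendScalars.{0,0,0} (grpAlgInc k G H)).obj A) :=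
  ModuleCat.ofHom (Y := (ModuleCat.restrictScalars (grpAlgInc k G H)).obj
      ((ModuleCat.coextendScalars.{0,0,0} (grpAlgInc k G H)).obj A))
  { toFun := fun a => (ModuleCat.CoextendScalars.equiv (grpAlgInc k G H) A).symm
      { toFun := fun x => pr k G H x • a
        map_add' := fun x y => by
          exact (congrArg (· • a) ((pr k G H).map_add x y)).trans (add_smul _ _ _)
        map_smul' := fun c x => by
          exact (congrArg (· • a) (pr_mul_left k G H c x)).trans (mul_smul _ _ _) }
    map_add' := fun a b => by
      apply ModuleCat.CoextendScalars.ext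
      ext x
      exact smul_add _ _ _
    map_smul' := fun c a => by
      apply ModuleCat.CoextendScalars.ext
      ext x
      exact ((congrArg (· • a) (pr_mul_right k G H c x)).trans (mul_smul _ _ _)).symm }

/-- Evaluation of an element of the coinduced module. -/
def ev (A : ModuleCat.{0} (MonoidAlgebra k H))
    (φ : (ModuleCat.coextendScalars.{0,0,0} (grpAlgInc k G H)).obj A) (x : MonoidAlgebra k G) : A :=
  ModuleCat.CoextendScalars.equiv (grpAlgInc k G H) A φ x

lemma ev_zero (A : ModuleCat.{0} (MonoidAlgebra k H)) (x : MonoidAlgebra k G) :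
    ev k G H A 0 x = 0 := rfl

lemma ev_add (A : ModuleCat.{0} (MonoidAlgebra k H))
    (φ ψ : (ModuleCat.coextendScalars.{0,0,0} (grpAlgInc k G H)).obj A) (x : MonoidAlgebra k G) :
    ev k G H A (φ + ψ) x = ev k G H A φ x + ev k G H A ψ x := rfl

lemma ev_smul (A : ModuleCat.{0} (MonoidAlgebra k H)) (s : MonoidAlgebra k G)
    (φ : (ModuleCat.coextendScalars.{0,0,0} (grpAlgInc k G H)).obj A) (x : MonoidAlgebra k G) :
    ev k G H A (s • φ) x = ev k G H A φ (x * s) := rfl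

lemma toCoind_nat {A B : ModuleCat.{0} (MonoidAlgebra k H)} (f : A ⟶ B) :
    f ≫ toCoind k G H B = toCoind k G H A ≫ (ModuleCat.restrictScalars (grpAlgInc k G H)).map
      ((ModuleCat.coextendScalars.{0,0,0} (grpAlgInc k G H)).map f) := by
  ext a
  apply ModuleCat.CoextendScalars.ext
  ext x
  exact (f.hom.map_smul _ _).symm

variable {k G H}
variable {F : ModuleCat.{0} (MonoidAlgebra k H) ⥤ ModuleCat.{0} (MonoidAlgebra k G)}
    (adj : F ⊣ ModuleCat.restrictScalars.{0} (grpAlgInc k G H))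

/-- The unit as a function into the underlying `kG`-module. -/
def eta (A : ModuleCat.{0} (MonoidAlgebra k H)) (a : A) : F.obj A := adj.unit.app A a

lemma eta_smul (A : ModuleCat.{0} (MonoidAlgebra k H)) (x : MonoidAlgebra k H) (a : A) :
    eta adj A (x • a) = grpAlgInc k G H x • eta adj A a := (adj.unit.app A).hom.map_smul x a

lemma eta_add (A : ModuleCat.{0} (MonoidAlgebra k H)) (a b : A) :
    eta adj A (a + b) = eta adj A a + eta adj A b := (adj.unit.app A).hom.map_add a b

lemma eta_zero (A : ModuleCat.{0} (MonoidAlgebra k H)) :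
    eta adj A 0 = 0 := (adj.unit.app A).hom.map_zero

lemma span_eta (A : ModuleCat.{0} (MonoidAlgebra k H)) :
    Submodule.span (MonoidAlgebra k G) (Set.range (eta adj A)) = ⊤ := by
  set N := Submodule.span (MonoidAlgebra k G) (Set.range (eta adj A))
  have h : ModuleCat.ofHom N.mkQ = 0 := by
    apply (adj.homEquiv _ _).injective
    rw [adj.homEquiv_unit, adj.homEquiv_unit]
    ext a
    change N.mkQ (eta adj A a) = 0
    rw [Submodule.mkQ_apply, Submodule.Quotient.mk_eq_zero]
    exact Submodule.subset_span ⟨a, rfl⟩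
  rw [← N.ker_mkQ]
  rw [LinearMap.ker_eq_top]
  exact congrArg ModuleCat.Hom.hom h

/-- `⊕_{G/H} A → ind A`. -/
def Phi (A : ModuleCat.{0} (MonoidAlgebra k H)) : (G ⧸ H →₀ A) →+ F.obj A :=
  Finsupp.liftAddHom fun q =>
    { toFun := fun a => (MonoidAlgebra.single q.out (1 : k)) • eta adj A a
      map_zero' := by rw [eta_zero, smul_zero]
      map_add' := fun a b => by rw [eta_add, smul_add] }

lemma Phi_single (A : ModuleCat.{0} (MonoidAlgebra k H)) (q : G ⧸ H) (a : A) :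
    Phi adj A (Finsupp.single q a) = (MonoidAlgebra.single q.out (1 : k)) • eta adj A a := by
  rw [Phi, Finsupp.liftAddHom_apply_single]; rfl

lemma single_smul_mem (A : ModuleCat.{0} (MonoidAlgebra k H)) (g : G) (t : k) (a : A) :
    (MonoidAlgebra.single g t) • eta adj A a ∈ (Phi adj A).range := by
  have hg : (QuotientGroup.mk g : G ⧸ H).out⁻¹ * g ∈ H :=
    QuotientGroup.eq.1 (QuotientGroup.out_eq' _)
  refine ⟨Finsupp.single (QuotientGroup.mk g) ((MonoidAlgebra.single (⟨_, hg⟩ : H) t) • a), ?_⟩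
  rw [Phi_single, eta_smul, smul_smul, grpAlgInc_single, MonoidAlgebra.single_mul_single]
  simp

lemma smul_mem_range (A : ModuleCat.{0} (MonoidAlgebra k H)) (x : MonoidAlgebra k G)
    (y : F.obj A) (hy : y ∈ (Phi adj A).range) : x • y ∈ (Phi adj A).range := by
  obtain ⟨c, rfl⟩ := hy
  induction c using Finsupp.induction_linear with
  | zero => rw [map_zero, smul_zero]; exact zero_mem _
  | add a b ha hb => rw [map_add, smul_add]; exact add_mem ha hb
  | single q a =>
    rw [Phi_single]
    induction x using MonoidAlgebra.induction_linear with
    | zero => rw [zero_smul]; exact zero_mem _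
    | add a b ha hb => rw [add_smul]; exact add_mem ha hb
    | single g t =>
      rw [smul_smul, MonoidAlgebra.single_mul_single]
      exact single_smul_mem adj A _ _ _

lemma Phi_surj (A : ModuleCat.{0} (MonoidAlgebra k H)) (y : F.obj A) :
    ∃ c, Phi adj A c = y := by
  have hy : y ∈ Submodule.span (MonoidAlgebra k G) (Set.range (eta adj A)) := by
    rw [span_eta]; trivial
  change y ∈ (Phi adj A).range
  induction hy using Submodule.span_induction with
  | mem x hx =>
    obtain ⟨a, rfl⟩ := hx
    have := single_smul_mem adj A 1 1 a
    rwa [← MonoidAlgebra.one_def, one_smul] at this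
  | zero => exact zero_mem _
  | add x y _ _ hx hy => exact add_mem hx hy
  | smul a x _ hx => exact smul_mem_range adj A a x hx

/-- The comparison `ind A → coind A`. -/
def theta (A : ModuleCat.{0} (MonoidAlgebra k H)) :
    F.obj A ⟶ (ModuleCat.coextendScalars.{0,0,0} (grpAlgInc k G H)).obj A :=
  (adj.homEquiv _ _).symm (toCoind k G H A)

lemma theta_eta (A : ModuleCat.{0} (MonoidAlgebra k H)) (a : A) :
    theta adj A (eta adj A a) = (toCoind k G H A).hom a := by
  have : adj.homEquiv _ _ (theta adj A) = toCoind k G H A := Equiv.apply_symm_apply _ _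
  rw [adj.homEquiv_unit] at this
  exact congrArg (fun f => f.hom a) this

lemma ev_theta_eta (A : ModuleCat.{0} (MonoidAlgebra k H)) (a : A) (x : MonoidAlgebra k G) :
    ev k G H A (theta adj A (eta adj A a)) x = pr k G H x • a := by
  rw [theta_eta]
  rfl

lemma theta_Phi (A : ModuleCat.{0} (MonoidAlgebra k H)) (c : G ⧸ H →₀ A) (q : G ⧸ H) :
    ev k G H A (theta adj A (Phi adj A c)) (MonoidAlgebra.single q.out⁻¹ (1 : k)) = c q := by
  classical
  induction c using Finsupp.induction_linear with
  | zero => simp only [map_zero]; rfl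
  | add a b ha hb =>
    rw [map_add, map_add, ev_add, ha, hb, Finsupp.add_apply]
  | single p a =>
    rw [Phi_single, map_smul, ev_smul, ev_theta_eta,
      MonoidAlgebra.single_mul_single, Finsupp.single_apply]
    split_ifs with h
    · subst h
      rw [pr_single_mem k G H _ (by simp)]
      have : (⟨(Quotient.out p)⁻¹ * Quotient.out p, by simp⟩ : H) = 1 := by ext; simp
      rw [this, mul_one, ← MonoidAlgebra.one_def, one_smul]
    · rw [pr_single_not_mem, zero_smul]
      intro h'
      have := QuotientGroup.eq.2 h'
      rw [QuotientGroup.out_eq', QuotientGroup.out_eq'] at this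
      exact h this.symm

lemma theta_inj (A : ModuleCat.{0} (MonoidAlgebra k H)) : Function.Injective (theta adj A) := by
  rw [injective_iff_map_eq_zero]
  intro y hy
  obtain ⟨c, rfl⟩ := Phi_surj adj A y
  have : c = 0 := by
    ext q
    rw [← theta_Phi adj A c q, hy]
    rfl
  rw [this, map_zero]

lemma theta_nat {A B : ModuleCat.{0} (MonoidAlgebra k H)} (f : A ⟶ B) :
    F.map f ≫ theta adj B = theta adj A ≫
      (ModuleCat.coextendScalars.{0,0,0} (grpAlgInc k G H)).map f := by
  rw [theta, theta, ← adj.homEquiv_naturality_left_symm, ← adj.homEquiv_naturality_right_symm,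
    toCoind_nat]

lemma ind_mono
    {F : ModuleCat.{0} (MonoidAlgebra k H) ⥤ ModuleCat.{0} (MonoidAlgebra k G)}
    (adj : F ⊣ ModuleCat.restrictScalars.{0} (grpAlgInc k G H)) : F.PreservesMonomorphisms where
  preserves {A B} f hf := by
    have : Mono (theta adj A) := (ModuleCat.mono_iff_injective _).2 (theta_inj adj A)
    have h2 : PreservesLimits (ModuleCat.coextendScalars.{0,0,0} (grpAlgInc k G H)) :=
      (ModuleCat.restrictCoextendScalarsAdj _).rightAdjoint_preservesLimits
    have h3 : Mono (F.map f ≫ theta adj B) := by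
      rw [theta_nat]
      infer_instance
    exact mono_of_mono _ (theta adj B)

end concrete

/-- Restriction to any subgroup maps `GProj(kG)^⊥` into `GProj(kH)^⊥` and
`^⊥GInj(kG)` into `^⊥GInj(kH)`. -/
theorem statement14 (k : Type) [CommRing k] (G : Type) [Group G] (H : Subgroup G)
    (M : ModuleCat (MonoidAlgebra k G)) :
    (M ∈ gprojPerp (MonoidAlgebra k G) →
      (ModuleCat.restrictScalars (grpAlgInc k G H)).obj M ∈ gprojPerp (MonoidAlgebra k H)) ∧
    (M ∈ ginjPerp (MonoidAlgebra k G) →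
      (ModuleCat.restrictScalars (grpAlgInc k G H)).obj M ∈ ginjPerp (MonoidAlgebra k H)) := by
  have := res_isRightAdjoint (grpAlgInc k G H)
  have adj := Adjunction.ofIsRightAdjoint (ModuleCat.restrictScalars.{0} (grpAlgInc k G H))
  exact main_of_exact _ adj (ind_mono adj) (coind_epi k G H) M

end
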